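/- Let k be an odd positive integer and let Λ(k) be the presented group with generators ρ0, ρ1, ρ2 and defining relations ρ0² = ρ1² = ρ2² = (ρ0ρ1)^{3k} = (ρ0ρ2)² = (ρ1ρ2)⁴ = 1 and ρ0ρ1ρ2ρ1ρ0ρ1ρ2ρ1ρ2 = 1. Then: the order of Λ(k) equals 24k; the element ρ0ρ1 has order exactly 3k and the element ρ1ρ2 has order exactly 4; Λ(k) with its generating involutions ρ0, ρ1, ρ2 satisfies the intersection condition; the subgroup generated by ρ0ρ1 and ρ1ρ2 is all of Λ(k); the subgroup N generated by ρ2 and ρ1ρ2ρ1 is a normal subgroup isomorphic to the Klein four-group, equal to the normal closure of {ρ2}; and the quotient Λ(k)/N is isomorphic to the dihedral group of order 6k. -/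

import Mathlib

/-- The intersection condition for a group generated by `n` involutions. -/
def interCond {G : Type*} [Group G] {n : ℕ} (ρ : Fin n → G) : Prop :=
  ∀ I J : Set (Fin n),
    Subgroup.closure (ρ '' I) ⊓ Subgroup.closure (ρ '' J) = Subgroup.closure (ρ '' (I ∩ J))

/-- The defining relations of the group `Λ(k)`:
`ρ0² = ρ1² = ρ2² = (ρ0ρ1)^{3k} = (ρ0ρ2)² = (ρ1ρ2)⁴ = 1` and `ρ0ρ1ρ2ρ1ρ0ρ1ρ2ρ1ρ2 = 1`. -/
def lamRels (k : ℕ) : Set (FreeGroup (Fin 3)) :=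
  {(FreeGroup.of 0) ^ 2, (FreeGroup.of 1) ^ 2, (FreeGroup.of 2) ^ 2,
   (FreeGroup.of 0 * FreeGroup.of 1) ^ (3 * k),
   (FreeGroup.of 0 * FreeGroup.of 2) ^ 2,
   (FreeGroup.of 1 * FreeGroup.of 2) ^ 4,
   FreeGroup.of 0 * FreeGroup.of 1 * FreeGroup.of 2 * FreeGroup.of 1 * FreeGroup.of 0 *
     FreeGroup.of 1 * FreeGroup.of 2 * FreeGroup.of 1 * FreeGroup.of 2}

/-- The group `Λ(k)`. -/
abbrev Lam (k : ℕ) : Type := PresentedGroup (lamRels k)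

/-- The generator `ρ_i` of `Λ(k)`. -/
def lr (k : ℕ) (i : Fin 3) : Lam k := PresentedGroup.of i

open DihedralGroup

/-- The homomorphism from the dihedral group of order `2n` determined by a rotation `x` with
`x ^ n = 1` and an involution `a` inverting `x`. -/
def dihedralLift {G : Type*} [Group G] {n : ℕ} (x a : G) (hx : x ^ n = 1) (ha : a * a = 1)
    (hax : a * x * a = x⁻¹) : DihedralGroup n →* G :=
  let p : ZMod n →+ Additive G :=
    ZMod.lift n ⟨zmultiplesHom (Additive G) (Additive.ofMul x), by
      simpa using congrArg Additive.ofMul hx⟩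
  have hp (i : ZMod n) : a * (p i).toMul * a = (p (-i)).toMul := by
    obtain ⟨j, rfl⟩ := ZMod.intCast_surjective i
    have hinv : a⁻¹ = a := inv_eq_of_mul_eq_one_right ha
    have hconj := conj_zpow (i := j) (a := a) (b := x)
    rw [hinv, hax] at hconj
    rw [← Int.cast_neg, ZMod.lift_coe, ZMod.lift_coe]
    simpa using hconj.symm
  MonoidHom.mk'
    (fun g => match g with
      | r i => (p i).toMul
      | sr i => a * (p i).toMul)
    (by
      have hp' (i : ZMod n) : (p i).toMul * a = a * (p (-i)).toMul := by
        rw [← hp, ← mul_assoc, ← mul_assoc, ha, one_mul]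
      rintro (i | i) (j | j)
      · simp
      · simp only [r_mul_sr, sub_eq_neg_add, map_add, toMul_add, ← mul_assoc, hp']
      · simp [mul_assoc]
      · simp only [sr_mul_sr, sub_eq_neg_add, map_add, toMul_add, ← mul_assoc, hp])

theorem dihedralLift_r_one {G : Type*} [Group G] {n : ℕ} (x a : G) (hx : x ^ n = 1)
    (ha : a * a = 1) (hax : a * x * a = x⁻¹) : dihedralLift x a hx ha hax (r 1) = x := by
  have h := ZMod.lift_coe n ⟨zmultiplesHom (Additive G) (Additive.ofMul x), by
      simpa using congrArg Additive.ofMul hx⟩ 1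
  simpa [dihedralLift] using congrArg Additive.toMul h

theorem dihedralLift_sr_zero {G : Type*} [Group G] {n : ℕ} (x a : G) (hx : x ^ n = 1)
    (ha : a * a = 1) (hax : a * x * a = x⁻¹) : dihedralLift x a hx ha hax (sr 0) = a := by
  simp [dihedralLift]

section CommutingInvolutions

variable {G : Type*} [Group G] {x y : G}

theorem mem_closure_pair_of_commuting_involutions (hx : x * x = 1) (hy : y * y = 1)
    (hxy : x * y = y * x) {g : G} :
    g ∈ Subgroup.closure {x, y} ↔ g = 1 ∨ g = x ∨ g = y ∨ g = x * y := by
  constructor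
  · intro hg
    have hx' : x⁻¹ = x := inv_eq_of_mul_eq_one_right hx
    have hy' : y⁻¹ = y := inv_eq_of_mul_eq_one_right hy
    induction hg using Subgroup.closure_induction with
    | mem g hg => rcases hg with rfl | rfl <;> simp
    | one => simp
    | mul g h _ _ hg hh =>
      rcases hg with rfl | rfl | rfl | rfl <;> rcases hh with rfl | rfl | rfl | rfl <;> grind
    | inv g _ hg => rcases hg with rfl | rfl | rfl | rfl <;> simp [hx', hy', hxy]
  · have h₁ : x ∈ Subgroup.closure {x, y} := Subgroup.subset_closure (by simp)
    have h₂ : y ∈ Subgroup.closure {x, y} := Subgroup.subset_closure (by simp)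
    rintro (rfl | rfl | rfl | rfl)
    exacts [one_mem _, h₁, h₂, mul_mem h₁ h₂]

theorem isKleinFour_closure_pair (hx : x * x = 1) (hy : y * y = 1) (hxy : x * y = y * x)
    (hx1 : x ≠ 1) (hy1 : y ≠ 1) (hne : x ≠ y) : IsKleinFour (Subgroup.closure {x, y}) where
  card_four := by
    have hset : (Subgroup.closure {x, y} : Set G) = {1, x, y, x * y} := by
      ext g
      simp [mem_closure_pair_of_commuting_involutions hx hy hxy]
    have hxy1 : 1 ≠ x * y := fun h => hne (mul_left_cancel (hx.trans h))
    change Nat.card (Subgroup.closure {x, y} : Set G) = 4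
    classical
    rw [hset, Nat.card_coe_set_eq, Set.ncard_eq_toFinset_card']
    simp [Finset.card_insert_of_notMem, hx1.symm, hy1.symm, hne, hxy1, hx1, hy1]
  exponent_two := by
    have hdvd : Monoid.exponent (Subgroup.closure {x, y}) ∣ 2 := by
      refine Monoid.exponent_dvd_of_forall_pow_eq_one fun g => Subtype.ext ?_
      obtain ⟨g, hg⟩ := g
      rw [mem_closure_pair_of_commuting_involutions hx hy hxy] at hg
      rw [SubmonoidClass.coe_pow, OneMemClass.coe_one, pow_two]
      rcases hg with rfl | rfl | rfl | rfl <;> grind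
    refine ((Nat.dvd_prime Nat.prime_two).1 hdvd).resolve_left fun h => hx1 ?_
    have := (Monoid.exp_eq_one_iff.1 h).elim ⟨x, Subgroup.subset_closure (by simp)⟩ 1
    exact congrArg Subtype.val this

end CommutingInvolutions

/-- An involution that conjugates generators of a subgroup into it normalizes the subgroup. -/
theorem mem_normalizer_closure_of_involution {G : Type*} [Group G] {S : Set G} {t : G}
    (ht : t * t = 1) (h : ∀ s ∈ S, t * s * t ∈ Subgroup.closure S) :
    t ∈ Subgroup.normalizer (Subgroup.closure S : Set G) := by
  have hinv : t⁻¹ = t := inv_eq_of_mul_eq_one_right ht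
  have key : ∀ g ∈ Subgroup.closure S, t * g * t ∈ Subgroup.closure S := by
    intro g hg
    have hle : Subgroup.closure S ≤ (Subgroup.closure S).comap (MulAut.conj t).toMonoidHom := by
      rw [Subgroup.closure_le]
      intro s hs
      simpa [hinv] using h s hs
    simpa [hinv] using hle hg
  rw [Subgroup.mem_normalizer_iff]
  intro g
  rw [hinv]
  refine ⟨key g, fun hg => ?_⟩
  have hg' := key _ hg
  rwa [show t * (t * g * t) * t = (t * t) * g * (t * t) by group, ht, one_mul, mul_one] at hg'

/-- It suffices to know that the subgroups generated by subsets of the generators are the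
intersections of the subgroups generated by all but one of them. -/
theorem interCond_of_iInf {G : Type*} [Group G] {n : ℕ} {ρ : Fin n → G}
    (h : ∀ I : Set (Fin n), ∀ g, (∀ i ∉ I, g ∈ Subgroup.closure (ρ '' {i}ᶜ)) →
      g ∈ Subgroup.closure (ρ '' I)) : interCond ρ := by
  intro I J
  refine le_antisymm (fun g hg => ?_)
    (le_inf (Subgroup.closure_mono (Set.image_mono Set.inter_subset_left))
      (Subgroup.closure_mono (Set.image_mono Set.inter_subset_right)))
  have hle {K : Set (Fin n)} {i : Fin n} (hi : i ∉ K) (hg : g ∈ Subgroup.closure (ρ '' K)) :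
      g ∈ Subgroup.closure (ρ '' {i}ᶜ) :=
    Subgroup.closure_mono (Set.image_mono (Set.subset_compl_singleton_iff.2 hi)) hg
  refine h _ g fun i hi => ?_
  by_cases hiI : i ∈ I
  · exact hle (fun hiJ => hi ⟨hiI, hiJ⟩) hg.2
  · exact hle hiI hg.1

namespace Lam

variable (k : ℕ)

theorem lr_zero_mul_self : lr k 0 * lr k 0 = 1 := by
  have h := PresentedGroup.one_of_mem (rels := lamRels k) (x := FreeGroup.of 0 ^ 2)
    (by simp [lamRels])
  rwa [pow_two, map_mul] at h

theorem lr_one_mul_self : lr k 1 * lr k 1 = 1 := by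
  have h := PresentedGroup.one_of_mem (rels := lamRels k) (x := FreeGroup.of 1 ^ 2)
    (by simp [lamRels])
  rwa [pow_two, map_mul] at h

theorem lr_two_mul_self : lr k 2 * lr k 2 = 1 := by
  have h := PresentedGroup.one_of_mem (rels := lamRels k) (x := FreeGroup.of 2 ^ 2)
    (by simp [lamRels])
  rwa [pow_two, map_mul] at h

theorem lr_zero_mul_lr_one_pow : (lr k 0 * lr k 1) ^ (3 * k) = 1 := by
  have h := PresentedGroup.one_of_mem (rels := lamRels k)
    (x := (FreeGroup.of 0 * FreeGroup.of 1) ^ (3 * k)) (by simp [lamRels])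
  rwa [map_pow, map_mul] at h

theorem lr_zero_mul_lr_two_pow : (lr k 0 * lr k 2) ^ 2 = 1 := by
  have h := PresentedGroup.one_of_mem (rels := lamRels k)
    (x := (FreeGroup.of 0 * FreeGroup.of 2) ^ 2) (by simp [lamRels])
  rwa [map_pow, map_mul] at h

theorem lr_one_mul_lr_two_pow : (lr k 1 * lr k 2) ^ 4 = 1 := by
  have h := PresentedGroup.one_of_mem (rels := lamRels k)
    (x := (FreeGroup.of 1 * FreeGroup.of 2) ^ 4) (by simp [lamRels])
  rwa [map_pow, map_mul] at h

theorem lr_word : lr k 0 * lr k 1 * lr k 2 * lr k 1 * lr k 0 * lr k 1 * lr k 2 * lr k 1 *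
    lr k 2 = 1 := by
  have h := PresentedGroup.one_of_mem (rels := lamRels k)
    (x := FreeGroup.of 0 * FreeGroup.of 1 * FreeGroup.of 2 * FreeGroup.of 1 * FreeGroup.of 0 *
      FreeGroup.of 1 * FreeGroup.of 2 * FreeGroup.of 1 * FreeGroup.of 2) (by simp [lamRels])
  simp only [map_mul] at h
  exact h

theorem lr_zero_mul_lr_two : lr k 0 * lr k 2 = lr k 2 * lr k 0 := by
  have h := lr_zero_mul_lr_two_pow k
  have h₀ := lr_zero_mul_self k
  have h₂ := lr_two_mul_self k
  rw [pow_two] at h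
  grind

theorem lr_two_mul_conj : lr k 2 * (lr k 1 * lr k 2 * lr k 1) =
    lr k 1 * lr k 2 * lr k 1 * lr k 2 := by
  have h := lr_one_mul_lr_two_pow k
  have h₁ := lr_one_mul_self k
  have h₂ := lr_two_mul_self k
  simp only [pow_succ, pow_zero, one_mul] at h
  grind

theorem conj_mul_self :
    (lr k 1 * lr k 2 * lr k 1) * (lr k 1 * lr k 2 * lr k 1) = 1 := by
  have h₁ := lr_one_mul_self k
  have h₂ := lr_two_mul_self k
  grind

theorem lr_zero_conj : lr k 0 * (lr k 1 * lr k 2 * lr k 1) * lr k 0 =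
    lr k 2 * (lr k 1 * lr k 2 * lr k 1) := by
  have h := lr_word k
  have h₁ := lr_one_mul_self k
  have h₂ := lr_two_mul_self k
  grind

/-- The action of `Λ(k)` on the four vertices of a tetrahedron. -/
def toPerm : Lam k →* Equiv.Perm (Fin 4) :=
  PresentedGroup.toGroup (f := ![Equiv.swap 0 1, Equiv.swap 1 2, Equiv.swap 0 1 * Equiv.swap 2 3])
    (by
      rintro x (rfl | rfl | rfl | rfl | rfl | rfl | rfl)
      · simp; decide
      · simp; decide
      · simp; decide
      · rw [map_pow, pow_mul, map_mul, FreeGroup.lift_apply_of, FreeGroup.lift_apply_of,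
          show (![Equiv.swap 0 1, Equiv.swap 1 2, Equiv.swap 0 1 * Equiv.swap 2 3] 0 *
            ![Equiv.swap 0 1, Equiv.swap 1 2, Equiv.swap 0 1 * Equiv.swap 2 3] 1 :
              Equiv.Perm (Fin 4)) ^ 3 = 1 by decide, one_pow]
      · simp; decide
      · simp; decide
      · simp; decide)

theorem toPerm_one : toPerm k (lr k 1) = Equiv.swap 1 2 := PresentedGroup.toGroup.of _

theorem toPerm_two : toPerm k (lr k 2) = Equiv.swap 0 1 * Equiv.swap 2 3 :=
  PresentedGroup.toGroup.of _

/-- The homomorphism from `Λ(k)` to the dihedral group that kills `ρ2`. -/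
def toDihedral : Lam k →* DihedralGroup (3 * k) :=
  PresentedGroup.toGroup (f := ![sr 0, sr 1, 1])
    (by
      rintro x (rfl | rfl | rfl | rfl | rfl | rfl | rfl)
      · simp [pow_two]
      · simp [pow_two]
      · simp
      · rw [map_pow, map_mul, FreeGroup.lift_apply_of, FreeGroup.lift_apply_of]
        simp
      · simp [pow_two]
      · simp [pow_succ]
      · simp)

theorem toDihedral_zero : toDihedral k (lr k 0) = sr 0 := PresentedGroup.toGroup.of _

theorem toDihedral_one : toDihedral k (lr k 1) = sr 1 := PresentedGroup.toGroup.of _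

theorem toDihedral_two : toDihedral k (lr k 2) = 1 := PresentedGroup.toGroup.of _

/-- The section of `toDihedral` with image `⟨ρ0, ρ1⟩`. -/
def ofDihedral : DihedralGroup (3 * k) →* Lam k :=
  dihedralLift (lr k 0 * lr k 1) (lr k 0) (lr_zero_mul_lr_one_pow k) (lr_zero_mul_self k) (by
    rw [mul_inv_rev, ← mul_assoc, lr_zero_mul_self, one_mul,
      inv_eq_of_mul_eq_one_right (lr_zero_mul_self k),
      inv_eq_of_mul_eq_one_right (lr_one_mul_self k)])

theorem ofDihedral_sr_zero : ofDihedral k (sr 0) = lr k 0 := dihedralLift_sr_zero ..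

theorem ofDihedral_sr_one : ofDihedral k (sr 1) = lr k 1 := by
  have h : (sr 1 : DihedralGroup (3 * k)) = sr 0 * r 1 := by simp
  rw [h, map_mul, ofDihedral_sr_zero, ofDihedral, dihedralLift_r_one, ← mul_assoc,
    lr_zero_mul_self, one_mul]

theorem hom_ext {G : Type*} [Group G] {φ ψ : Lam k →* G} (h₀ : φ (lr k 0) = ψ (lr k 0))
    (h₁ : φ (lr k 1) = ψ (lr k 1)) (h₂ : φ (lr k 2) = ψ (lr k 2)) : φ = ψ := by
  refine PresentedGroup.ext fun i => ?_
  fin_cases i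
  exacts [h₀, h₁, h₂]

theorem eq_top_of_mem {H : Subgroup (Lam k)} (h₀ : lr k 0 ∈ H) (h₁ : lr k 1 ∈ H)
    (h₂ : lr k 2 ∈ H) : H = ⊤ := by
  refine (Subgroup.eq_top_iff' H).2 (PresentedGroup.generated_by _ H fun i => ?_)
  fin_cases i
  exacts [h₀, h₁, h₂]

theorem toDihedral_ofDihedral (g : DihedralGroup (3 * k)) :
    toDihedral k (ofDihedral k g) = g := by
  have hr : toDihedral k (ofDihedral k (r 1)) = r 1 := by
    rw [ofDihedral, dihedralLift_r_one, map_mul, toDihedral_zero, toDihedral_one]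
    simp
  have hri (i : ZMod (3 * k)) : toDihedral k (ofDihedral k (r i)) = r i := by
    obtain ⟨j, rfl⟩ := ZMod.intCast_surjective i
    rw [← r_one_zpow, map_zpow, map_zpow, hr]
  rcases g with i | i
  · exact hri i
  · rw [show (sr i : DihedralGroup (3 * k)) = sr 0 * r i by simp, map_mul, map_mul, hri,
      ofDihedral_sr_zero, toDihedral_zero]

theorem ker_toDihedral : (toDihedral k).ker = Subgroup.normalClosure {lr k 2} := by
  refine le_antisymm (fun g hg => ?_) ?_
  · set π := QuotientGroup.mk' (Subgroup.normalClosure {lr k 2})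
    have h : π = (π.comp (ofDihedral k)).comp (toDihedral k) := by
      apply hom_ext
      · simp only [MonoidHom.comp_apply, toDihedral_zero, ofDihedral_sr_zero]
      · simp only [MonoidHom.comp_apply, toDihedral_one, ofDihedral_sr_one]
      · simp only [MonoidHom.comp_apply, toDihedral_two, map_one]
        exact (QuotientGroup.eq_one_iff _).2 (Subgroup.subset_normalClosure rfl)
    rw [← QuotientGroup.eq_one_iff]
    change π g = 1
    rw [h, MonoidHom.comp_apply, MonoidHom.mem_ker.1 hg, map_one]
  · exact Subgroup.normalClosure_le_normal (by simpa using toDihedral_two k)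

theorem normal_closure :
    (Subgroup.closure ({lr k 2, lr k 1 * lr k 2 * lr k 1} : Set (Lam k))).Normal := by
  have h₀ := lr_zero_mul_self k
  have h₁ := lr_one_mul_self k
  have h₂ := lr_two_mul_self k
  rw [← Subgroup.normalizer_eq_top_iff]
  apply eq_top_of_mem
  · refine mem_normalizer_closure_of_involution h₀ ?_
    rintro s (rfl | rfl)
    · rw [lr_zero_mul_lr_two, mul_assoc (lr k 2), h₀, mul_one]
      exact Subgroup.subset_closure (by simp)
    · rw [lr_zero_conj]
      exact mul_mem (Subgroup.subset_closure (by simp)) (Subgroup.subset_closure (by simp))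
  · refine mem_normalizer_closure_of_involution h₁ ?_
    rintro s (rfl | rfl)
    · exact Subgroup.subset_closure (by simp)
    · rw [show lr k 1 * (lr k 1 * lr k 2 * lr k 1) * lr k 1 = lr k 2 by grind]
      exact Subgroup.subset_closure (by simp)
  · exact Subgroup.le_normalizer (Subgroup.subset_closure (by simp))

theorem closure_eq_normalClosure :
    Subgroup.closure ({lr k 2, lr k 1 * lr k 2 * lr k 1} : Set (Lam k)) =
      Subgroup.normalClosure {lr k 2} := by
  apply le_antisymm
  · rw [Subgroup.closure_le]
    have h : lr k 2 ∈ Subgroup.normalClosure {lr k 2} := Subgroup.subset_normalClosure rfl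
    rintro s (rfl | rfl)
    · exact h
    · have hc := Subgroup.normalClosure_normal.conj_mem _ h (lr k 1)
      rwa [inv_eq_of_mul_eq_one_right (lr_one_mul_self k)] at hc
  · have := normal_closure k
    exact Subgroup.normalClosure_le_normal (by simpa using Subgroup.subset_closure (by simp))

theorem isKleinFour_normalClosure :
    IsKleinFour (Subgroup.normalClosure {lr k 2} : Subgroup (Lam k)) := by
  rw [← closure_eq_normalClosure]
  refine isKleinFour_closure_pair (lr_two_mul_self k) (conj_mul_self k) (lr_two_mul_conj k)
    (fun h => ?_) (fun h => ?_) (fun h => ?_) <;>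
  · have := congrArg (toPerm k) h
    simp only [map_mul, map_one, toPerm_one, toPerm_two] at this
    revert this
    decide

theorem lr_two_ne_one : lr k 2 ≠ 1 := by
  intro h
  have := congrArg (toPerm k) h
  rw [map_one, toPerm_two] at this
  revert this
  decide

/-- The quotient of `Λ(k)` by the normal closure of `ρ2` is dihedral. -/
noncomputable def quotientEquiv :
    Lam k ⧸ (Subgroup.normalClosure {lr k 2} : Subgroup (Lam k)) ≃* DihedralGroup (3 * k) :=
  (QuotientGroup.quotientMulEquivOfEq (ker_toDihedral k).symm).trans
    (QuotientGroup.quotientKerEquivOfRightInverse _ _ (toDihedral_ofDihedral k))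

theorem nat_card : Nat.card (Lam k) = 24 * k := by
  have := isKleinFour_normalClosure k
  rw [Subgroup.card_eq_card_quotient_mul_card_subgroup (Subgroup.normalClosure {lr k 2}),
    Nat.card_congr (quotientEquiv k).toEquiv, DihedralGroup.nat_card, IsKleinFour.card_four]
  ring

theorem orderOf_lr_zero_mul_lr_one : orderOf (lr k 0 * lr k 1) = 3 * k := by
  refine Nat.dvd_antisymm (orderOf_dvd_of_pow_eq_one (lr_zero_mul_lr_one_pow k)) ?_
  have h := orderOf_map_dvd (toDihedral k) (lr k 0 * lr k 1)
  rwa [map_mul, toDihedral_zero, toDihedral_one, sr_mul_sr, sub_zero, orderOf_r_one] at h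

theorem orderOf_lr_one_mul_lr_two : orderOf (lr k 1 * lr k 2) = 4 := by
  refine orderOf_eq_prime_pow (p := 2) (n := 1) (fun h => ?_) (lr_one_mul_lr_two_pow k)
  have := congrArg (toPerm k) h
  simp only [map_mul, map_pow, map_one, toPerm_one, toPerm_two] at this
  revert this
  decide

theorem closure_rotations :
    Subgroup.closure ({lr k 0 * lr k 1, lr k 1 * lr k 2} : Set (Lam k)) = ⊤ := by
  set H := Subgroup.closure ({lr k 0 * lr k 1, lr k 1 * lr k 2} : Set (Lam k))
  have ha : lr k 0 * lr k 1 ∈ H := Subgroup.subset_closure (by simp)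
  have hb : lr k 1 * lr k 2 ∈ H := Subgroup.subset_closure (by simp)
  have h₁ := lr_one_mul_self k
  have h₂ := lr_two_mul_self k
  have hword := lr_word k
  have hinv : (lr k 1 * lr k 2)⁻¹ = lr k 2 * lr k 1 := by
    rw [mul_inv_rev, inv_eq_of_mul_eq_one_right h₁, inv_eq_of_mul_eq_one_right h₂]
  have hc : lr k 2 ∈ H := by
    have h : (lr k 0 * lr k 1 * (lr k 1 * lr k 2)⁻¹ * (lr k 0 * lr k 1) *
        (lr k 1 * lr k 2)⁻¹) * lr k 2 = 1 := by
      rw [hinv]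
      simpa only [mul_assoc] using hword
    rw [← inv_eq_of_mul_eq_one_right h]
    exact inv_mem (mul_mem (mul_mem (mul_mem ha (inv_mem hb)) ha) (inv_mem hb))
  have hb' : lr k 1 ∈ H := (Subgroup.mul_mem_cancel_right H hc).1 hb
  exact eq_top_of_mem k ((Subgroup.mul_mem_cancel_right H hb').1 ha) hb' hc

theorem toDihedral_of_mem_closure_compl_zero {g : Lam k}
    (hg : g ∈ Subgroup.closure (lr k '' {0}ᶜ)) :
    toDihedral k g = 1 ∨ toDihedral k g = sr 1 := by
  have hle : Subgroup.closure (lr k '' {0}ᶜ) ≤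
      (Subgroup.closure {sr 1, 1}).comap (toDihedral k) := by
    rw [Subgroup.closure_le]
    rintro _ ⟨i, hi, rfl⟩
    apply Subgroup.subset_closure
    fin_cases i
    · exact absurd rfl hi
    · exact Or.inl (toDihedral_one k)
    · exact Or.inr (toDihedral_two k)
  have h := (mem_closure_pair_of_commuting_involutions (sr_mul_self 1) (one_mul 1) (by simp)).1
    (Subgroup.mem_comap.1 (hle hg))
  rw [mul_one] at h
  tauto

theorem mem_closure_compl_one {g : Lam k} (hg : g ∈ Subgroup.closure (lr k '' {1}ᶜ)) :
    g = 1 ∨ g = lr k 0 ∨ g = lr k 2 ∨ g = lr k 0 * lr k 2 := by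
  rw [← mem_closure_pair_of_commuting_involutions (lr_zero_mul_self k) (lr_two_mul_self k)
    (lr_zero_mul_lr_two k)]
  refine Subgroup.closure_mono ?_ hg
  rintro _ ⟨i, hi, rfl⟩
  fin_cases i
  · exact Or.inl rfl
  · exact absurd rfl hi
  · exact Or.inr rfl

theorem ofDihedral_toDihedral_of_mem_closure_compl_two {g : Lam k}
    (hg : g ∈ Subgroup.closure (lr k '' {2}ᶜ)) : ofDihedral k (toDihedral k g) = g := by
  have hle : Subgroup.closure (lr k '' {2}ᶜ) ≤ (ofDihedral k).range := by
    rw [Subgroup.closure_le]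
    rintro _ ⟨i, hi, rfl⟩
    fin_cases i
    · exact ⟨_, ofDihedral_sr_zero k⟩
    · exact ⟨_, ofDihedral_sr_one k⟩
    · exact absurd rfl hi
  obtain ⟨x, rfl⟩ := hle hg
  rw [toDihedral_ofDihedral]

theorem interCond_lr (hk : 0 < k) : interCond (lr k) := by
  have hne : (sr 0 : DihedralGroup (3 * k)) ≠ sr 1 := by
    have : Fact (1 < 3 * k) := ⟨by lia⟩
    simp
  have h01 {g : Lam k} (h₀ : g ∈ Subgroup.closure (lr k '' {0}ᶜ))
      (h₁ : g ∈ Subgroup.closure (lr k '' {1}ᶜ)) : g = 1 ∨ g = lr k 2 := by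
    have hne1 : (sr 0 : DihedralGroup (3 * k)) ≠ 1 := nofun
    have h := toDihedral_of_mem_closure_compl_zero k h₀
    rcases mem_closure_compl_one k h₁ with rfl | rfl | rfl | rfl
    · exact Or.inl rfl
    · rw [toDihedral_zero] at h
      exact (h.elim hne1 hne).elim
    · exact Or.inr rfl
    · rw [map_mul, toDihedral_zero, toDihedral_two, mul_one] at h
      exact (h.elim hne1 hne).elim
  have h02 {g : Lam k} (h₀ : g ∈ Subgroup.closure (lr k '' {0}ᶜ))
      (h₂ : g ∈ Subgroup.closure (lr k '' {2}ᶜ)) : g = 1 ∨ g = lr k 1 := by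
    rw [← ofDihedral_toDihedral_of_mem_closure_compl_two k h₂]
    rcases toDihedral_of_mem_closure_compl_zero k h₀ with h | h
    · exact Or.inl (by rw [h, map_one])
    · exact Or.inr (by rw [h, ofDihedral_sr_one])
  have h12 {g : Lam k} (h₁ : g ∈ Subgroup.closure (lr k '' {1}ᶜ))
      (h₂ : g ∈ Subgroup.closure (lr k '' {2}ᶜ)) : g = 1 ∨ g = lr k 0 := by
    have h := ofDihedral_toDihedral_of_mem_closure_compl_two k h₂
    rcases mem_closure_compl_one k h₁ with rfl | rfl | rfl | rfl
    · exact Or.inl rfl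
    · exact Or.inr rfl
    · rw [toDihedral_two, map_one] at h
      exact Or.inl h.symm
    · rw [map_mul, toDihedral_zero, toDihedral_two, mul_one, ofDihedral_sr_zero] at h
      exact Or.inr h.symm
  refine interCond_of_iInf fun I g hg => ?_
  have hmem {i : Fin 3} (hi : i ∈ I) : lr k i ∈ Subgroup.closure (lr k '' I) :=
    Subgroup.subset_closure ⟨i, hi, rfl⟩
  have hsub {j : Fin 3} (hj : j ∉ I) (h : ∀ i ≠ j, i ∈ I) : g ∈ Subgroup.closure (lr k '' I) :=
    Subgroup.closure_mono (Set.image_mono fun i hi => h i hi) (hg j hj)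
  have hone {i : Fin 3} (hi : i ∈ I) (h : g = 1 ∨ g = lr k i) :
      g ∈ Subgroup.closure (lr k '' I) := by
    rcases h with rfl | rfl
    exacts [one_mem _, hmem hi]
  by_cases i0 : (0 : Fin 3) ∈ I <;> by_cases i1 : (1 : Fin 3) ∈ I <;>
    by_cases i2 : (2 : Fin 3) ∈ I
  · rw [eq_top_of_mem k (hmem i0) (hmem i1) (hmem i2)]
    trivial
  · exact hsub i2 (by simp [Fin.forall_fin_succ, i0, i1])
  · exact hsub i1 (by simp [Fin.forall_fin_succ, i0, i2])
  · exact hone i0 (h12 (hg 1 i1) (hg 2 i2))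
  · exact hsub i0 (by simp [Fin.forall_fin_succ, i1, i2])
  · exact hone i1 (h02 (hg 0 i0) (hg 2 i2))
  · exact hone i2 (h01 (hg 0 i0) (hg 1 i1))
  · have hg1 : g = 1 := by
      rcases h01 (hg 0 i0) (hg 1 i1) with h | h
      · exact h
      · have h' := ofDihedral_toDihedral_of_mem_closure_compl_two k (hg 2 i2)
        rw [h, toDihedral_two, map_one] at h'
        exact absurd h'.symm (lr_two_ne_one k)
    rw [hg1]
    exact one_mem _

end Lam


/-- For every odd positive integer `k`: `|Λ(k)| = 24k`; `ρ0ρ1` has order `3k` and `ρ1ρ2` has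
order `4`; `Λ(k)` satisfies the intersection condition; `⟨ρ0ρ1, ρ1ρ2⟩` is all of `Λ(k)`;
the subgroup `N = ⟨ρ2, ρ1ρ2ρ1⟩` is a normal Klein four-subgroup equal to the normal closure
of `{ρ2}`; and `Λ(k)/N` is dihedral of order `6k`. (So `Λ(k)` is the automorphism group of a
tight non-orientably-regular polyhedron of type `{3k, 4}`.) -/
theorem tight_nonorientable_3k_4 (k : ℕ) (hk : 0 < k) (hkodd : Odd k) :
    Nat.card (Lam k) = 24 * k ∧
    orderOf (lr k 0 * lr k 1) = 3 * k ∧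
    orderOf (lr k 1 * lr k 2) = 4 ∧
    interCond (lr k) ∧
    Subgroup.closure ({lr k 0 * lr k 1, lr k 1 * lr k 2} : Set (Lam k)) = ⊤ ∧
    Subgroup.closure ({lr k 2, lr k 1 * lr k 2 * lr k 1} : Set (Lam k)) =
      Subgroup.normalClosure {lr k 2} ∧
    (Subgroup.closure ({lr k 2, lr k 1 * lr k 2 * lr k 1} : Set (Lam k))).Normal ∧
    Nonempty ((Subgroup.normalClosure {lr k 2} : Subgroup (Lam k)) ≃*
      Multiplicative (ZMod 2 × ZMod 2)) ∧
    Nonempty ((Lam k ⧸ (Subgroup.normalClosure {lr k 2} : Subgroup (Lam k))) ≃*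
      DihedralGroup (3 * k)) := by
  have := Lam.isKleinFour_normalClosure k
  exact ⟨Lam.nat_card k, Lam.orderOf_lr_zero_mul_lr_one k, Lam.orderOf_lr_one_mul_lr_two k,
    Lam.interCond_lr k hk, Lam.closure_rotations k, Lam.closure_eq_normalClosure k,
    Lam.normal_closure k, IsKleinFour.nonempty_mulEquiv, ⟨Lam.quotientEquiv k⟩⟩
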